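/- arXiv:1810.09646 — 2 statements merged into one kernel-verified Lean document; each statement's English description precedes it below -/
import Mathlib

section
/- For all mm-spaces X and Y and every p ∈ [1,∞], one has (1/2)·d_{GM,p}(X,Y) ≤ d^{emb}_{GM,p}(X,Y). Moreover, for p = ∞ equality holds: (1/2)·d_{GM,∞}(X,Y) = d^{emb}_{GM,∞}(X,Y). In particular d_{GM,p}(X,Y) = ∞ if and only if d^{emb}_{GM,p}(X,Y) = ∞. -/
open MeasureTheory Metric ENNReal

universe u

/-- A bundled compact metric space equipped with its Borel σ-algebra. -/
structure CompactMetricBorel : Type (u + 1) where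
  (carrier : Type u)
  [met : MetricSpace carrier]
  [msp : MeasurableSpace carrier]
  [bor : BorelSpace carrier]
  [cpt : CompactSpace carrier]

attribute [instance] CompactMetricBorel.met CompactMetricBorel.msp
  CompactMetricBorel.bor CompactMetricBorel.cpt

/-- Monge transport `p`-distance between Borel measures `α, β` on a metric space `Z`:
the infimum over measurable maps `φ` with `φ_#α = β` of the `L^p(α)`-norm of
`z ↦ d_Z(z, φ z)` (the essential supremum when `p = ⊤`); it is `⊤` when no such map
exists, since `sInf ∅ = ⊤` in `ℝ≥0∞`. -/
noncomputable def dMonge {Z : Type*} [PseudoMetricSpace Z] [MeasurableSpace Z]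
    (p : ℝ≥0∞) (α β : Measure Z) : ℝ≥0∞ :=
  sInf {c | ∃ φ : Z → Z, Measurable φ ∧ Measure.map φ α = β ∧
    c = eLpNorm (fun z => dist z (φ z)) p α}

/-- Gromov–Monge `p`-distance (map formulation): the infimum over measurable
measure-preserving `φ : X → Y` of the `L^p(μX ⊗ μX)`-norm of the distortion
`(x,x') ↦ |d_X(x,x') - d_Y(φ x, φ x')|`; `⊤` when no measure-preserving map exists. -/
noncomputable def dGM {X Y : Type*} [PseudoMetricSpace X] [MeasurableSpace X]
    [PseudoMetricSpace Y] [MeasurableSpace Y]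
    (p : ℝ≥0∞) (μX : Measure X) (μY : Measure Y) : ℝ≥0∞ :=
  sInf {c | ∃ φ : X → Y, Measurable φ ∧ Measure.map φ μX = μY ∧
    c = eLpNorm (fun z : X × X => dist z.1 z.2 - dist (φ z.1) (φ z.2)) p (μX.prod μX)}

/-- Embedding formulation of Gromov–Monge distance: the infimum over compact metric
spaces `Z` and isometric embeddings `φX : X → Z`, `φY : Y → Z` of the Monge `p`-distance
between the pushforward measures `(φX)_#μX` and `(φY)_#μY` in `Z`. -/
noncomputable def dGMemb {X Y : Type u} [MetricSpace X] [MeasurableSpace X]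
    [MetricSpace Y] [MeasurableSpace Y]
    (p : ℝ≥0∞) (μX : Measure X) (μY : Measure Y) : ℝ≥0∞ :=
  sInf {c | ∃ (W : CompactMetricBorel.{u}) (φX : X → W.carrier) (φY : Y → W.carrier),
    Isometry φX ∧ Isometry φY ∧
    c = dMonge p (Measure.map φX μX) (Measure.map φY μY)}

/-- If a closed relation holds `μ ⊗ μ`-almost everywhere, it holds on the support of `μ`. -/
lemma mem_of_ae_prod_of_mem_support {Z : Type*} [TopologicalSpace Z] [MeasurableSpace Z]
    {μ : Measure Z} [SFinite μ] {C : Set (Z × Z)} (hC : IsClosed C)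
    (h : ∀ᵐ z ∂μ.prod μ, z ∈ C) {a b : Z} (ha : a ∈ μ.support) (hb : b ∈ μ.support) :
    (a, b) ∈ C := by
  by_contra hab
  obtain ⟨U, hU, V, hV, hUV⟩ := mem_nhds_prod_iff.1 (hC.isOpen_compl.mem_nhds hab)
  have hzero : μ.prod μ (U ×ˢ V) = 0 := measure_mono_null hUV h
  rw [Measure.prod_prod] at hzero
  exact (ENNReal.mul_pos ((Measure.mem_support_iff_forall a).1 ha U hU).ne'
    ((Measure.mem_support_iff_forall b).1 hb V hV).ne').ne' hzero

/-- Gluing of two compact metric spaces along a relation of distortion at most `2 * ε`, in such a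
way that related points are at distance `ε`. -/
lemma exists_gluing_of_distortion_le {X Y : Type u} [MetricSpace X] [CompactSpace X]
    [MetricSpace Y] [CompactSpace Y] {S : Set (X × Y)} (hS : S.Nonempty) {ε : ℝ} (hε : 0 < ε)
    (H : ∀ a ∈ S, ∀ b ∈ S, |dist a.1 b.1 - dist a.2 b.2| ≤ 2 * ε) :
    ∃ (W : CompactMetricBorel.{u}) (iX : X → W.carrier) (iY : Y → W.carrier),
      Isometry iX ∧ Isometry iY ∧ ∀ a ∈ S, dist (iX a.1) (iY a.2) = ε := by
  have : Nonempty S := hS.to_subtype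
  let m : MetricSpace (X ⊕ Y) := glueMetricApprox (fun s : S => s.1.1) (fun s : S => s.1.2) ε hε
    fun a b => H a a.2 b b.2
  let W : CompactMetricBorel.{u} :=
    { carrier := X ⊕ Y
      met := m
      msp := borel (X ⊕ Y)
      bor := @BorelSpace.mk _ _ (borel _) rfl
      cpt := inferInstanceAs (CompactSpace (X ⊕ Y)) }
  refine ⟨W, Sum.inl, Sum.inr, Isometry.of_dist_eq fun _ _ => rfl,
    Isometry.of_dist_eq fun _ _ => rfl, fun a ha => ?_⟩
  exact glueDist_glued_points (fun s : S => s.1.1) (fun s : S => s.1.2) ε ⟨a, ha⟩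

/-- A transport map between the images of `X` and `Y` in a common space induces a transport map
from `X` to `Y`. -/
lemma exists_transport_of_isometry {X Y W : Type*}
    [MetricSpace X] [MeasurableSpace X] [BorelSpace X]
    [MetricSpace Y] [CompactSpace Y] [MeasurableSpace Y] [BorelSpace Y]
    {μX : Measure X} {μY : Measure Y} [IsProbabilityMeasure μY]
    [MetricSpace W] [MeasurableSpace W] [BorelSpace W]
    {iX : X → W} {iY : Y → W} (hX : Isometry iX) (hY : Isometry iY)
    {φ : W → W} (hφ : Measurable φ) (hmap : (μX.map iX).map φ = μY.map iY) :
    ∃ ψ : X → Y, Measurable ψ ∧ μX.map ψ = μY ∧ ∀ᵐ x ∂μX, iY (ψ x) = φ (iX x) := by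
  have hYe : MeasurableEmbedding iY := hY.isClosedEmbedding.measurableEmbedding
  have hXm : Measurable iX := hX.continuous.measurable
  obtain ⟨g, hg, hgY⟩ := hYe.exists_measurable_extend measurable_id
    fun _ => nonempty_of_isProbabilityMeasure μY
  have hmap' : μX.map (φ ∘ iX) = μY.map iY := by rw [← hmap, Measure.map_map hφ hXm]
  refine ⟨g ∘ (φ ∘ iX), hg.comp (hφ.comp hXm), ?_, ?_⟩
  · rw [← Measure.map_map hg (hφ.comp hXm), hmap', Measure.map_map hg hYe.measurable, hgY,
      Measure.map_id]
  · have hrange : ∀ᵐ w ∂μX.map (φ ∘ iX), w ∈ Set.range iY := by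
      rw [hmap']
      exact (ae_map_iff hYe.measurable.aemeasurable hYe.measurableSet_range).2
        (Filter.Eventually.of_forall Set.mem_range_self)
    filter_upwards [ae_of_ae_map (hφ.comp hXm).aemeasurable hrange] with x ⟨y, hy⟩
    have hgy : g (iY y) = y := congrFun hgY y
    simp only [Function.comp_apply] at hy ⊢
    rw [← hy, hgy]

/-- The distortion of a map between two subspaces of a metric space is bounded by twice its
displacement, in `L^p`. -/
lemma eLpNorm_distortion_le {X Y W : Type*} [MetricSpace X] [CompactSpace X]
    [MeasurableSpace X] [BorelSpace X] [MetricSpace Y]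
    [MetricSpace W] [CompactSpace W] [MeasurableSpace W] [BorelSpace W]
    {μX : Measure X} [IsProbabilityMeasure μX] {iX : X → W} {iY : Y → W} (hX : Isometry iX) (hY : Isometry iY)
    {φ : W → W} (hφ : Measurable φ) {ψ : X → Y} (hψ : ∀ᵐ x ∂μX, iY (ψ x) = φ (iX x))
    {p : ℝ≥0∞} (hp : 1 ≤ p) :
    eLpNorm (fun z : X × X => dist z.1 z.2 - dist (ψ z.1) (ψ z.2)) p (μX.prod μX) ≤
      2 * eLpNorm (fun w => dist w (φ w)) p (μX.map iX) := by
  have hXm : Measurable iX := hX.continuous.measurable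
  have hdist : Measurable fun w => dist w (φ w) := measurable_id.dist hφ
  set D : X → ℝ := fun x => dist (iX x) (φ (iX x)) with hD
  have hDm : Measurable D := hdist.comp hXm
  have hDnorm : eLpNorm (fun w => dist w (φ w)) p (μX.map iX) = eLpNorm D p μX :=
    eLpNorm_map_measure hdist.aestronglyMeasurable hXm.aemeasurable
  have hfst : eLpNorm (D ∘ Prod.fst) p (μX.prod μX) = eLpNorm D p μX :=
    eLpNorm_comp_measurePreserving hDm.aestronglyMeasurable measurePreserving_fst
  have hsnd : eLpNorm (D ∘ Prod.snd) p (μX.prod μX) = eLpNorm D p μX :=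
    eLpNorm_comp_measurePreserving hDm.aestronglyMeasurable measurePreserving_snd
  calc
    _ ≤ eLpNorm (D ∘ Prod.fst + D ∘ Prod.snd) p (μX.prod μX) := by
      refine eLpNorm_mono_ae_real ?_
      filter_upwards [Measure.quasiMeasurePreserving_fst.ae hψ,
        Measure.quasiMeasurePreserving_snd.ae hψ] with z h₁ h₂
      rw [← hX.dist_eq, ← hY.dist_eq, h₁, h₂]
      exact dist_dist_dist_le _ _ _ _
    _ ≤ eLpNorm (D ∘ Prod.fst) p (μX.prod μX) + eLpNorm (D ∘ Prod.snd) p (μX.prod μX) :=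
      eLpNorm_add_le (hDm.comp measurable_fst).aestronglyMeasurable
        (hDm.comp measurable_snd).aestronglyMeasurable hp
    _ = _ := by rw [hfst, hsnd, hDnorm, two_mul]

section GromovMonge

variable {X Y : Type u}
  [MetricSpace X] [CompactSpace X] [MeasurableSpace X] [BorelSpace X]
  [MetricSpace Y] [CompactSpace Y] [MeasurableSpace Y] [BorelSpace Y]
  {μX : Measure X} {μY : Measure Y} [IsProbabilityMeasure μX]

lemma half_dGM_le_dGMemb [IsProbabilityMeasure μY] {p : ℝ≥0∞} (hp : 1 ≤ p) :
    1 / 2 * dGM p μX μY ≤ dGMemb p μX μY := by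
  refine le_sInf ?_
  rintro _ ⟨W, iX, iY, hX, hY, rfl⟩
  refine le_sInf ?_
  rintro _ ⟨φ, hφ, hmap, rfl⟩
  obtain ⟨ψ, hψ, hψmap, hψφ⟩ := exists_transport_of_isometry hX hY hφ hmap
  rw [one_div, ENNReal.inv_mul_le_iff two_ne_zero ofNat_ne_top]
  exact (sInf_le ⟨ψ, hψ, hψmap, rfl⟩ : dGM p μX μY ≤ _).trans
    (eLpNorm_distortion_le hX hY hφ hψφ hp)

/-- A transport map of essential distortion at most `2 * ε` bounds the embedding Gromov–Monge
distance by `ε`. -/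
lemma dGMemb_le_ofReal {φ : X → Y} (hφ : Measurable φ) (hmap : μX.map φ = μY) {ε : ℝ} (hε : 0 < ε)
    (h : ∀ᵐ z ∂μX.prod μX, |dist z.1 z.2 - dist (φ z.1) (φ z.2)| ≤ 2 * ε) (p : ℝ≥0∞) :
    dGMemb p μX μY ≤ ENNReal.ofReal ε := by
  let g : X → X × Y := fun x => (x, φ x)
  have hg : Measurable g := measurable_id.prodMk hφ
  have : IsProbabilityMeasure (μX.map g) := Measure.isProbabilityMeasure_map hg.aemeasurable
  let C : Set ((X × Y) × (X × Y)) := {z | |dist z.1.1 z.2.1 - dist z.1.2 z.2.2| ≤ 2 * ε}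
  have hC : IsClosed C := isClosed_le (by fun_prop) continuous_const
  have hae : ∀ᵐ z ∂(μX.map g).prod (μX.map g), z ∈ C := by
    rw [Measure.map_prod_map _ _ hg hg]
    exact (ae_map_iff (hg.prodMap hg).aemeasurable hC.measurableSet).2 h
  obtain ⟨W, iX, iY, hX, hY, hXY⟩ := exists_gluing_of_distortion_le
    (Measure.nonempty_support (IsProbabilityMeasure.ne_zero (μX.map g))) hε
    fun a ha b hb => mem_of_ae_prod_of_mem_support hC hae ha hb
  have hXe : MeasurableEmbedding iX := hX.isClosedEmbedding.measurableEmbedding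
  have hYm : Measurable iY := hY.continuous.measurable
  obtain ⟨Φ, hΦ, hΦX⟩ := hXe.exists_measurable_extend (hYm.comp hφ) fun w => ⟨w⟩
  have hΦmap : (μX.map iX).map Φ = μY.map iY := by
    rw [Measure.map_map hΦ hXe.measurable, hΦX, ← Measure.map_map hYm hφ, hmap]
  have : IsProbabilityMeasure (μX.map iX) :=
    Measure.isProbabilityMeasure_map hXe.measurable.aemeasurable
  have hbound : ∀ᵐ w ∂μX.map iX, ‖dist w (Φ w)‖ ≤ ε := by
    rw [hXe.ae_map_iff]
    filter_upwards [ae_of_ae_map hg.aemeasurable (Measure.support_mem_ae (μ := μX.map g))]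
      with x hx
    have hΦx : Φ (iX x) = iY (φ x) := congrFun hΦX x
    rw [hΦx, Real.norm_of_nonneg dist_nonneg]
    exact (hXY _ hx).le
  calc
    dGMemb p μX μY ≤ dMonge p (μX.map iX) (μY.map iY) := sInf_le ⟨W, iX, iY, hX, hY, rfl⟩
    _ ≤ eLpNorm (fun w => dist w (Φ w)) p (μX.map iX) := sInf_le ⟨Φ, hΦ, hΦmap, rfl⟩
    _ ≤ _ := by simpa using eLpNorm_le_of_ae_bound hbound

lemma dGMemb_top_le : dGMemb ⊤ μX μY ≤ 1 / 2 * dGM ⊤ μX μY := by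
  rw [one_div, ← ENNReal.mul_le_iff_le_inv two_ne_zero ofNat_ne_top]
  refine le_sInf ?_
  rintro _ ⟨φ, hφ, hmap, rfl⟩
  rw [ENNReal.mul_le_iff_le_inv two_ne_zero ofNat_ne_top]
  set c := eLpNorm (fun z : X × X => dist z.1 z.2 - dist (φ z.1) (φ z.2)) ⊤ (μX.prod μX) with hc
  by_cases hctop : c = ⊤
  · simp [hctop, ENNReal.mul_top]
  refine ENNReal.le_of_forall_pos_le_add fun δ hδ _ => ?_
  have hae : ∀ᵐ z ∂μX.prod μX,
      |dist z.1 z.2 - dist (φ z.1) (φ z.2)| ≤ 2 * (c.toReal / 2 + δ) := by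
    have hess := ae_le_eLpNormEssSup (μ := μX.prod μX)
      (f := fun z : X × X => dist z.1 z.2 - dist (φ z.1) (φ z.2))
    rw [← eLpNorm_exponent_top, ← hc] at hess
    filter_upwards [hess] with z hz
    have hz' := ENNReal.toReal_mono hctop hz
    rw [toReal_enorm, Real.norm_eq_abs] at hz'
    linarith [δ.coe_nonneg]
  refine (dGMemb_le_ofReal hφ hmap (by positivity) hae ⊤).trans_eq ?_
  rw [ENNReal.ofReal_add (by positivity) δ.coe_nonneg, ENNReal.ofReal_div_of_pos two_pos,
    ENNReal.ofReal_toReal hctop, ENNReal.ofReal_coe_nnreal, ENNReal.ofReal_ofNat,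
    ENNReal.div_eq_inv_mul]

lemma dGMemb_lt_top {φ : X → Y} (hφ : Measurable φ) (hmap : μX.map φ = μY) (p : ℝ≥0∞) :
    dGMemb p μX μY < ⊤ := by
  refine (dGMemb_le_ofReal hφ hmap
    (ε := diam (Set.univ : Set X) + diam (Set.univ : Set Y) + 1) (by positivity)
    (Filter.Eventually.of_forall fun z => ?_) p).trans_lt ENNReal.ofReal_lt_top
  have hX : dist z.1 z.2 ≤ diam (Set.univ : Set X) :=
    dist_le_diam_of_mem isCompact_univ.isBounded (Set.mem_univ _) (Set.mem_univ _)
  have hY : dist (φ z.1) (φ z.2) ≤ diam (Set.univ : Set Y) :=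
    dist_le_diam_of_mem isCompact_univ.isBounded (Set.mem_univ _) (Set.mem_univ _)
  rw [abs_le]
  constructor <;> linarith [dist_nonneg (x := z.1) (y := z.2),
    dist_nonneg (x := φ z.1) (y := φ z.2)]

lemma dGM_eq_top_of_dGMemb_eq_top {p : ℝ≥0∞} (h : dGMemb p μX μY = ⊤) : dGM p μX μY = ⊤ := by
  refine sInf_eq_top.2 ?_
  rintro _ ⟨φ, hφ, hmap, -⟩
  exact absurd h (dGMemb_lt_top hφ hmap p).ne

end GromovMonge

/-- **Theorem.** For all mm-spaces `X`, `Y` and every `p ∈ [1,∞]`: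
`(1/2)·d_{GM,p}(X,Y) ≤ d^{emb}_{GM,p}(X,Y)`, with equality for `p = ∞`:
`(1/2)·d_{GM,∞}(X,Y) = d^{emb}_{GM,∞}(X,Y)`.  In particular `d_{GM,p}(X,Y) = ∞`
iff `d^{emb}_{GM,p}(X,Y) = ∞`. -/
theorem gromovMonge_le_embedding_formulation
    {X Y : Type u}
    [MetricSpace X] [CompactSpace X] [MeasurableSpace X] [BorelSpace X]
    [MetricSpace Y] [CompactSpace Y] [MeasurableSpace Y] [BorelSpace Y]
    (μX : Measure X) (μY : Measure Y)
    [IsProbabilityMeasure μX] [IsProbabilityMeasure μY]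
    [μX.IsOpenPosMeasure] [μY.IsOpenPosMeasure]
    (p : ℝ≥0∞) (hp : 1 ≤ p) :
    (1 / 2) * dGM p μX μY ≤ dGMemb p μX μY ∧
    (1 / 2) * dGM ⊤ μX μY = dGMemb ⊤ μX μY ∧
    (dGM p μX μY = ⊤ ↔ dGMemb p μX μY = ⊤) := by
  refine ⟨half_dGM_le_dGMemb hp, le_antisymm (half_dGM_le_dGMemb le_top) dGMemb_top_le,
    fun h => ?_, dGM_eq_top_of_dGMemb_eq_top⟩
  have hle := half_dGM_le_dGMemb (μX := μX) (μY := μY) hp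
  rw [h, ENNReal.mul_top (by simp)] at hle
  exact top_le_iff.1 hle
end

section
/- Let X and Y be mm-spaces and define, for r > 0, the functions h_X^r: X → ℝ, h_X^r(x) = μ_X(closed ball of radius r around x), and similarly h_Y^r. If inf over couplings μ of μ_X and μ_Y of ∫_{X×Y} (∫_0^∞ |h_X(x,r) − h_Y(y,r)| dr) μ(dx×dy) = 0, then for Lebesgue-almost every r > 0 the pushforward measures coincide: (h_X^r)_#μ_X = (h_Y^r)_#μ_Y as Borel probability measures on ℝ. -/
open MeasureTheory Metric ENNReal

/-- The local distance distribution `h_X(x,r) = μX(closed ball of radius r about x)`,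
as a real number. -/
noncomputable def localDistrib {X : Type*} [PseudoMetricSpace X] [MeasurableSpace X]
    (μX : Measure X) (x : X) (r : ℝ) : ℝ :=
  (μX (Metric.closedBall x r)).toReal

/-- The local distance distribution is jointly measurable in the centre and the radius. -/
theorem measurable_uncurry_localDistrib {X : Type*} [PseudoMetricSpace X]
    [SecondCountableTopology X] [MeasurableSpace X] [BorelSpace X]
    (μ : Measure X) [SFinite μ] :
    Measurable (fun p : X × ℝ => localDistrib μ p.1 p.2) := by
  have hs : MeasurableSet {q : (X × ℝ) × X | dist q.2 q.1.1 ≤ q.1.2} :=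
    measurableSet_le (by fun_prop) (by fun_prop)
  exact (measurable_measure_prodMk_left hs).ennreal_toReal

theorem norm_exp_mul_I_sub_exp_mul_I_le (a b : ℝ) :
    ‖Complex.exp (a * Complex.I) - Complex.exp (b * Complex.I)‖ ≤ |a - b| := by
  have h := Real.norm_exp_I_mul_ofReal_sub_one_le (x := a - b)
  have e : Complex.exp (a * Complex.I) - Complex.exp (b * Complex.I) =
      Complex.exp (b * Complex.I) * (Complex.exp (Complex.I * ((a - b : ℝ) : ℂ)) - 1) := by
    rw [mul_sub, ← Complex.exp_add, mul_one]
    congr 2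
    push_cast
    ring
  rw [e, norm_mul, Complex.norm_exp_ofReal_mul_I, one_mul]
  simpa using h

/-- Characteristic functions of real random variables on the same probability space differ by at
most `|t|` times their `L¹` distance. -/
theorem enorm_charFun_map_sub_charFun_map_le {Ω : Type*} [MeasurableSpace Ω] (μ : Measure Ω)
    [IsFiniteMeasure μ] {f g : Ω → ℝ} (hf : Measurable f) (hg : Measurable g) (t : ℝ) :
    ‖charFun (μ.map f) t - charFun (μ.map g) t‖ₑ ≤
      (∫⁻ ω, ENNReal.ofReal |f ω - g ω| ∂μ) * ENNReal.ofReal |t| := by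
  have hint : ∀ {u : Ω → ℝ}, Measurable u →
      Integrable (fun ω => Complex.exp (t * u ω * Complex.I)) μ := fun {u} hu => by
    refine Integrable.of_bound (C := 1) (by fun_prop) (.of_forall fun ω => ?_)
    rw [← Complex.ofReal_mul, Complex.norm_exp_ofReal_mul_I]
  rw [charFun_apply_real, charFun_apply_real, integral_map hf.aemeasurable (by fun_prop),
    integral_map hg.aemeasurable (by fun_prop), ← integral_sub (hint hf) (hint hg),
    ← lintegral_mul_const _ (by fun_prop)]
  refine (enorm_integral_le_lintegral_enorm _).trans (lintegral_mono fun ω => ?_)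
  rw [← ofReal_norm, ← ENNReal.ofReal_mul (abs_nonneg _), ← abs_mul]
  refine ENNReal.ofReal_le_ofReal ?_
  have h := norm_exp_mul_I_sub_exp_mul_I_le (t * f ω) (t * g ω)
  push_cast at h
  exact h.trans_eq (by congr 1; ring)

/-- The characteristic function of the law of a jointly measurable family depends measurably on
the parameter. -/
theorem measurable_charFun_map {Ω R : Type*} [MeasurableSpace Ω] [MeasurableSpace R]
    (μ : Measure Ω) [SFinite μ] {f : Ω × R → ℝ} (hf : Measurable f) (t : ℝ) :
    Measurable fun r => charFun (μ.map fun x => f (x, r)) t := by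
  have e : (fun r => charFun (μ.map fun x => f (x, r)) t) =
      fun r => ∫ x, Complex.exp (t * f (x, r) * Complex.I) ∂μ := by
    ext r
    rw [charFun_apply_real, integral_map (by fun_prop) (by fun_prop)]
  rw [e]
  have hm : StronglyMeasurable fun p : Ω × R => Complex.exp (t * f p * Complex.I) :=
    Measurable.stronglyMeasurable (by fun_prop)
  exact hm.integral_prod_left'.measurable

/-- Finite measures on the line whose characteristic functions agree at the rationals agree. -/
theorem ext_of_charFun_rat {μ ν : Measure ℝ} [IsFiniteMeasure μ] [IsFiniteMeasure ν]
    (h : ∀ q : ℚ, charFun μ q = charFun ν q) : μ = ν :=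
  Measure.ext_of_charFun <|
    Rat.denseRange_cast.equalizer continuous_charFun continuous_charFun (funext h)

/-- **Lemma.**  Let `X`, `Y` be mm-spaces and, for `r > 0`, let
`h_X^r : X → ℝ`, `h_X^r(x) = μX(closed ball of radius r about x)` (and similarly
`h_Y^r`).  If the infimum over couplings `μ` of `μX` and `μY` of
`∫_{X×Y} (∫_0^∞ |h_X(x,r) − h_Y(y,r)| dr) μ(dx×dy)` vanishes, then for Lebesgue-almost
every `r > 0` the pushforward measures coincide: `(h_X^r)_#μX = (h_Y^r)_#μY` as Borel
measures on `ℝ`. -/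
theorem pushforwards_of_localDistrib_ae_eq_of_inf_cost_zero
    {X Y : Type*}
    [MetricSpace X] [CompactSpace X] [MeasurableSpace X] [BorelSpace X]
    [MetricSpace Y] [CompactSpace Y] [MeasurableSpace Y] [BorelSpace Y]
    (μX : Measure X) (μY : Measure Y)
    [IsProbabilityMeasure μX] [IsProbabilityMeasure μY]
    [μX.IsOpenPosMeasure] [μY.IsOpenPosMeasure]
    (h : sInf {c | ∃ μ : Measure (X × Y), IsProbabilityMeasure μ ∧
        Measure.map Prod.fst μ = μX ∧ Measure.map Prod.snd μ = μY ∧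
        c = ∫⁻ z, (∫⁻ r in Set.Ioi (0 : ℝ),
              ENNReal.ofReal |localDistrib μX z.1 r - localDistrib μY z.2 r|) ∂μ} = 0) :
    ∀ᵐ r ∂(MeasureTheory.volume.restrict (Set.Ioi (0 : ℝ))),
      Measure.map (fun x => localDistrib μX x r) μX =
      Measure.map (fun y => localDistrib μY y r) μY := by
  have mX := measurable_uncurry_localDistrib μX
  have mY := measurable_uncurry_localDistrib μY
  have key : ∀ t : ℝ, ∀ᵐ r ∂(volume.restrict (Set.Ioi (0 : ℝ))),
      charFun (μX.map fun x => localDistrib μX x r) t =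
        charFun (μY.map fun y => localDistrib μY y r) t := by
    intro t
    have hG : (∫⁻ r in Set.Ioi (0 : ℝ), ‖charFun (μX.map fun x => localDistrib μX x r) t -
        charFun (μY.map fun y => localDistrib μY y r) t‖ₑ) / ENNReal.ofReal |t| ≤ 0 := by
      rw [← h]
      refine le_sInf ?_
      rintro c ⟨μ, hμ, hfst, hsnd, rfl⟩
      refine ENNReal.div_le_of_le_mul ?_
      have m₁ : Measurable fun p : (X × Y) × ℝ => localDistrib μX p.1.1 p.2 :=
        mX.comp (f := fun p : (X × Y) × ℝ => (p.1.1, p.2)) (by fun_prop)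
      have m₂ : Measurable fun p : (X × Y) × ℝ => localDistrib μY p.1.2 p.2 :=
        mY.comp (f := fun p : (X × Y) × ℝ => (p.1.2, p.2)) (by fun_prop)
      have mc : Measurable fun p : (X × Y) × ℝ =>
          ENNReal.ofReal |localDistrib μX p.1.1 p.2 - localDistrib μY p.1.2 p.2| := by fun_prop
      rw [lintegral_lintegral_swap mc.aemeasurable,
        ← lintegral_mul_const _ mc.lintegral_prod_left']
      refine lintegral_mono fun r => ?_
      have eX : (μX.map fun x => localDistrib μX x r) =
          μ.map fun z => localDistrib μX z.1 r := by
        conv_lhs => arg 2; rw [← hfst]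
        exact Measure.map_map mX.of_uncurry_right measurable_fst
      have eY : (μY.map fun y => localDistrib μY y r) =
          μ.map fun z => localDistrib μY z.2 r := by
        conv_lhs => arg 2; rw [← hsnd]
        exact Measure.map_map mY.of_uncurry_right measurable_snd
      rw [eX, eY]
      exact enorm_charFun_map_sub_charFun_map_le μ m₁.of_uncurry_right m₂.of_uncurry_right t
    have hG₀ := (ENNReal.div_eq_zero_iff.1 (le_zero_iff.1 hG)).resolve_right ENNReal.ofReal_ne_top
    have hG_ae := (lintegral_eq_zero_iff ((measurable_charFun_map μX mX t).sub
      (measurable_charFun_map μY mY t)).enorm).1 hG₀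
    filter_upwards [hG_ae] with r hr
    simpa [sub_eq_zero] using hr
  filter_upwards [ae_all_iff.2 fun q : ℚ => key q] with r hr
  exact ext_of_charFun_rat hr
end
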